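/- arXiv:1903.09789 — 2 statements merged into one kernel-verified Lean document; each statement's English description precedes it below -/
import Mathlib

section
/- Let G be a finite connected simple graph with at least two vertices. Then γ_qtR(G) = γ_t(G) + 1 if and only if γ_qtR(G) = 3. -/
/-- A Roman dominating function: labels in {0,1,2}, and every vertex labeled 0
has a neighbor labeled 2. -/
def IsRDF {V : Type*} (G : SimpleGraph V) (f : V → ℕ) : Prop :=
  (∀ v, f v ≤ 2) ∧ ∀ u, f u = 0 → ∃ v, G.Adj u v ∧ f v = 2

/-- A quasi-total Roman dominating function: an RDF such that every vertex labeled 2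
has a neighbor with positive label. -/
def IsQTRDF {V : Type*} (G : SimpleGraph V) (f : V → ℕ) : Prop :=
  IsRDF G f ∧ ∀ x, f x = 2 → ∃ y, G.Adj x y ∧ 1 ≤ f y

/-- A total Roman dominating function: an RDF such that every vertex with positive label
has a neighbor with positive label. -/
def IsTRDF {V : Type*} (G : SimpleGraph V) (f : V → ℕ) : Prop :=
  IsRDF G f ∧ ∀ v, 1 ≤ f v → ∃ w, G.Adj v w ∧ 1 ≤ f w

/-- The Roman domination number. -/
noncomputable def gammaR {V : Type*} [Fintype V] (G : SimpleGraph V) : ℕ :=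
  sInf {w | ∃ f : V → ℕ, IsRDF G f ∧ ∑ v, f v = w}

/-- The quasi-total Roman domination number. -/
noncomputable def gammaQTR {V : Type*} [Fintype V] (G : SimpleGraph V) : ℕ :=
  sInf {w | ∃ f : V → ℕ, IsQTRDF G f ∧ ∑ v, f v = w}

/-- The total Roman domination number. -/
noncomputable def gammaTR {V : Type*} [Fintype V] (G : SimpleGraph V) : ℕ :=
  sInf {w | ∃ f : V → ℕ, IsTRDF G f ∧ ∑ v, f v = w}

/-- A dominating set: every vertex outside it has a neighbor in it. -/
def IsDomSet {V : Type*} (G : SimpleGraph V) (D : Finset V) : Prop :=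
  ∀ v ∉ D, ∃ u ∈ D, G.Adj v u

/-- The domination number. -/
noncomputable def gammaDom {V : Type*} [Fintype V] (G : SimpleGraph V) : ℕ :=
  sInf {n | ∃ D : Finset V, IsDomSet G D ∧ D.card = n}

/-- A total dominating set: every vertex has a neighbor in it. -/
def IsTotalDomSet {V : Type*} (G : SimpleGraph V) (D : Finset V) : Prop :=
  ∀ v, ∃ u ∈ D, G.Adj v u

/-- The total domination number. -/
noncomputable def gammaT {V : Type*} [Fintype V] (G : SimpleGraph V) : ℕ :=
  sInf {n | ∃ D : Finset V, IsTotalDomSet G D ∧ D.card = n}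

/-- A packing: a set of vertices whose closed neighborhoods are pairwise disjoint. -/
def IsPacking {V : Type*} (G : SimpleGraph V) (B : Finset V) : Prop :=
  ∀ u ∈ B, ∀ v ∈ B, u ≠ v →
    ∀ w, ¬ ((w = u ∨ G.Adj u w) ∧ (w = v ∨ G.Adj v w))

/-- The packing number. -/
noncomputable def packingNumber {V : Type*} [Fintype V] (G : SimpleGraph V) : ℕ :=
  sSup {n | ∃ B : Finset V, IsPacking G B ∧ B.card = n}

theorem gammaT_le_card {V : Type*} [Fintype V] {G : SimpleGraph V} {D : Finset V}
    (hD : IsTotalDomSet G D) : gammaT G ≤ D.card :=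
  Nat.sInf_le ⟨D, hD, rfl⟩

theorem isQTRDF_one {V : Type*} {G : SimpleGraph V} : IsQTRDF G (fun _ => 1) := by
  simp [IsQTRDF, IsRDF]

theorem exists_isQTRDF_sum_eq_gammaQTR {V : Type*} [Fintype V] (G : SimpleGraph V) :
    ∃ f : V → ℕ, IsQTRDF G f ∧ ∑ v, f v = gammaQTR G :=
  Nat.sInf_mem (s := {w | ∃ f : V → ℕ, IsQTRDF G f ∧ ∑ v, f v = w}) ⟨_, _, isQTRDF_one, rfl⟩

theorem two_le_gammaT {V : Type*} [Fintype V] [Nonempty V] {G : SimpleGraph V}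
    (hG : ∀ v, ∃ w, G.Adj v w) : 2 ≤ gammaT G := by
  have hne : {n | ∃ D : Finset V, IsTotalDomSet G D ∧ D.card = n}.Nonempty :=
    ⟨_, Finset.univ, fun v => by simpa using hG v, rfl⟩
  obtain ⟨D, hD, hcard⟩ := Nat.sInf_mem hne
  obtain ⟨u, hu, -⟩ := hD (Classical.arbitrary V)
  obtain ⟨v, hv, huv⟩ := hD u
  have h : 1 < D.card := Finset.one_lt_card.2 ⟨u, hu, v, hv, huv.ne⟩
  exact h.trans_eq hcard

theorem sum_eq_card_pos_add_card_two {V : Type*} [Fintype V] {f : V → ℕ} (hf : ∀ v, f v ≤ 2) :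
    ∑ v, f v = {v | 1 ≤ f v}.ncard + {v | f v = 2}.ncard := by
  classical
  simp only [Set.ncard_eq_toFinset_card', Set.toFinset_ofPred, Finset.card_filter,
    ← Finset.sum_add_distrib]
  refine Finset.sum_congr rfl fun v _ => ?_
  have := hf v
  split_ifs <;> omega

/-- The positive vertices of a quasi-total Roman dominating function, with the isolated ones
replaced by neighbors, form a total dominating set. -/
theorem gammaT_add_card_two_le_sum {V : Type*} [Fintype V] {G : SimpleGraph V}
    (hG : ∀ v, ∃ w, G.Adj v w) {f : V → ℕ} (hf : IsQTRDF G f) :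
    gammaT G + {v | f v = 2}.ncard ≤ ∑ v, f v := by
  classical
  rw [sum_eq_card_pos_add_card_two hf.1.1]
  choose n hn using hG
  let g : V → V := fun v => if ∃ w, G.Adj v w ∧ 1 ≤ f w then v else n v
  let D : Finset V := {v | 1 ≤ f v}
  have key : ∀ v w, G.Adj v w → 1 ≤ f v → 1 ≤ f w → w ∈ D.image g := by
    intro v w hvw hv hw
    refine Finset.mem_image.2 ⟨w, by simpa [D] using hw, if_pos ⟨v, hvw.symm, hv⟩⟩
  have hD : IsTotalDomSet G (D.image g) := by
    intro v
    by_cases hv : 1 ≤ f v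
    · by_cases h : ∃ w, G.Adj v w ∧ 1 ≤ f w
      · obtain ⟨w, hvw, hw⟩ := h
        exact ⟨w, key v w hvw hv hw, hvw⟩
      · exact ⟨n v, Finset.mem_image.2 ⟨v, by simpa [D] using hv, if_neg h⟩, hn v⟩
    · obtain ⟨w, hvw, hw⟩ := hf.1.2 v (by omega)
      obtain ⟨y, hwy, hy⟩ := hf.2 w hw
      exact ⟨w, key y w hwy.symm hy (by omega), hvw⟩
  have h := (gammaT_le_card hD).trans Finset.card_image_le
  have hDc : {v | 1 ≤ f v}.ncard = D.card := by
    rw [← Set.ncard_coe_finset]; simp [D]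
  omega

theorem exists_adj_dist_lt {V : Type*} {G : SimpleGraph V} (hconn : G.Connected) {x v : V}
    (h : v ≠ x) : ∃ p, G.Adj v p ∧ G.dist p x < G.dist v x := by
  obtain ⟨p, hp⟩ := hconn.exists_walk_length_eq_dist v x
  cases p with
  | nil => exact absurd rfl h
  | cons hadj q =>
    refine ⟨_, hadj, ?_⟩
    have := SimpleGraph.dist_le q
    rw [SimpleGraph.Walk.length_cons] at hp
    omega

/-- Parents of the vertices outside a closed neighborhood, towards its center, together with the
center, form a total dominating set. -/
theorem gammaT_le_max_card_nonneighbors {V : Type*} [Fintype V] {G : SimpleGraph V}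
    (hconn : G.Connected) {x y : V} (hxy : G.Adj x y) :
    gammaT G ≤ max 2 ({v | v ≠ x ∧ ¬ G.Adj x v}.ncard + 1) := by
  classical
  let B : Finset V := {v | v ≠ x ∧ ¬ G.Adj x v}
  have hBc : {v | v ≠ x ∧ ¬ G.Adj x v}.ncard = B.card := by
    rw [← Set.ncard_coe_finset]; simp [B]
  have hB : ∀ v, v ∈ B ↔ v ≠ x ∧ ¬ G.Adj x v := by simp [B]
  rw [hBc]
  clear_value B
  rcases B.eq_empty_or_nonempty with h | h
  · have hD : IsTotalDomSet G {x, y} := by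
      intro v
      by_cases hv : v = x
      · exact ⟨y, by simp, hv ▸ hxy⟩
      · have := hB v
        simp only [h, Finset.notMem_empty, false_iff, not_and, not_not] at this
        exact ⟨x, by simp, (this hv).symm⟩
    exact (gammaT_le_card hD).trans (Finset.card_le_two.trans (le_max_left _ _))
  · choose! p hp using fun v (hv : v ≠ x) => exists_adj_dist_lt hconn hv
    have hD : IsTotalDomSet G (insert x (B.image p)) := by
      intro v
      by_cases hv : v = x
      · subst hv
        obtain ⟨b, hb, hmin⟩ := B.exists_min_image (fun b => G.dist b v) h
        have hb' := (hB b).1 hb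
        have hpb := hp b hb'.1
        refine ⟨p b, Finset.mem_insert_of_mem (Finset.mem_image_of_mem p hb), ?_⟩
        by_contra hnot
        have hne : p b ≠ v := fun e => hb'.2 (e ▸ hpb.1.symm)
        exact absurd (hmin _ ((hB _).2 ⟨hne, hnot⟩)) (not_le.2 hpb.2)
      · by_cases hxv : G.Adj x v
        · exact ⟨x, by simp, hxv.symm⟩
        · exact ⟨p v, Finset.mem_insert_of_mem (Finset.mem_image_of_mem p ((hB v).2 ⟨hv, hxv⟩)),
            (hp v hv).1⟩
    refine (gammaT_le_card hD).trans (le_max_of_le_right ?_)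
    exact (Finset.card_insert_le _ _).trans (Nat.add_le_add_right Finset.card_image_le 1)

theorem exists_two_neighbors {V : Type*} [Fintype V] {G : SimpleGraph V} (hconn : G.Connected)
    (hcard : 3 ≤ Fintype.card V) : ∃ c a b, a ≠ b ∧ G.Adj c a ∧ G.Adj c b := by
  classical
  have : Nontrivial V := Fintype.one_lt_card_iff_nontrivial.1 (by omega)
  obtain ⟨x⟩ := hconn.nonempty
  obtain ⟨y, hxy⟩ := hconn.preconnected.exists_adj_of_nontrivial x
  obtain ⟨z, hz⟩ : ∃ z, z ∉ ({x, y} : Finset V) := by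
    by_contra! h
    have h1 : Fintype.card V ≤ ({x, y} : Finset V).card := Finset.card_le_card fun v _ => h v
    have := Finset.card_le_two (a := x) (b := y)
    omega
  obtain ⟨w⟩ := hconn.preconnected x z
  obtain ⟨d, -, hd, hd'⟩ := w.exists_boundary_dart {x, y} (by simp) (by simpa using hz)
  have hadj := d.adj
  simp only [Set.mem_insert_iff, Set.mem_singleton_iff, not_or] at hd hd'
  rcases hd with h | h
  · exact ⟨x, y, d.snd, Ne.symm hd'.2, hxy, h ▸ hadj⟩
  · exact ⟨y, x, d.snd, Ne.symm hd'.1, hxy.symm, h ▸ hadj⟩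

theorem gammaT_le_max_card_sub_two {V : Type*} [Fintype V] {G : SimpleGraph V}
    (hconn : G.Connected) (hcard : 3 ≤ Fintype.card V) :
    gammaT G ≤ max 2 (Fintype.card V - 2) := by
  classical
  obtain ⟨c, a, b, hab, hca, hcb⟩ := exists_two_neighbors hconn hcard
  have h := gammaT_le_max_card_nonneighbors hconn hca
  have hsub : ({v | v ≠ c ∧ ¬ G.Adj c v} : Set V) ⊆ (({c, a, b} : Finset V)ᶜ : Finset V) := by
    rintro v ⟨hv, hcv⟩
    simp only [Finset.coe_compl, Set.mem_compl_iff, Finset.mem_coe, Finset.mem_insert,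
      Finset.mem_singleton]
    rintro (rfl | rfl | rfl) <;> contradiction
  have h' := Set.ncard_le_ncard hsub (Set.toFinite _)
  rw [Set.ncard_coe_finset, Finset.card_compl,
    Finset.card_eq_three.2 ⟨c, a, b, hca.ne, hcb.ne, hab, rfl⟩] at h'
  omega

theorem eq_one_of_card_two_eq_zero {V : Type*} [Fintype V] {G : SimpleGraph V} {f : V → ℕ}
    (hf : IsRDF G f) (h : {v | f v = 2}.ncard = 0) : f = fun _ => 1 := by
  have h2 : ∀ v, f v ≠ 2 := by
    rw [Set.ncard_eq_zero] at h
    exact fun v hv => Set.eq_empty_iff_forall_notMem.1 h v hv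
  funext v
  have h1 := hf.1 v
  have h0 : f v ≠ 0 := fun h0 => by
    obtain ⟨w, -, hw⟩ := hf.2 v h0
    exact h2 w hw
  have := h2 v
  omega

theorem card_nonneighbors_add_three_le_sum {V : Type*} [Fintype V] {G : SimpleGraph V}
    {f : V → ℕ} (hf : IsQTRDF G f) {x : V} (hx : {v | f v = 2} = {x}) :
    {v | v ≠ x ∧ ¬ G.Adj x v}.ncard + 3 ≤ ∑ v, f v := by
  have hfx : ∀ v, f v = 2 ↔ v = x := fun v => by simpa using Set.ext_iff.1 hx v
  obtain ⟨y, hxy, hy⟩ := hf.2 x ((hfx x).2 rfl)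
  have hsub : insert x (insert y {v | v ≠ x ∧ ¬ G.Adj x v}) ⊆ {v | 1 ≤ f v} := by
    rintro v (rfl | rfl | ⟨hv, hxv⟩)
    · simp [(hfx v).2 rfl]
    · exact hy
    · by_contra h0
      obtain ⟨w, hvw, hw⟩ := hf.1.2 v (by simpa using h0)
      exact hxv ((hfx w).1 hw ▸ hvw.symm)
  have h := Set.ncard_le_ncard hsub (Set.toFinite _)
  rw [Set.ncard_insert_of_notMem (by simp [hxy.ne]) (Set.toFinite _),
    Set.ncard_insert_of_notMem (by simp [hxy]) (Set.toFinite _)] at h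
  rw [sum_eq_card_pos_add_card_two hf.1.1, hx, Set.ncard_singleton]
  omega

theorem stmt5 {V : Type*} [Fintype V] (G : SimpleGraph V)
    (hconn : G.Connected) (hcard : 2 ≤ Fintype.card V) :
    gammaQTR G = gammaT G + 1 ↔ gammaQTR G = 3 := by
  have : Nontrivial V := Fintype.one_lt_card_iff_nontrivial.1 hcard
  have hG : ∀ v, ∃ w, G.Adj v w := hconn.preconnected.exists_adj_of_nontrivial
  have h2 := two_le_gammaT hG
  obtain ⟨f, hf, hsum⟩ := exists_isQTRDF_sum_eq_gammaQTR G
  have hle := gammaT_add_card_two_le_sum hG hf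
  have hzero : {v | f v = 2}.ncard = 0 → gammaQTR G = Fintype.card V := fun h0 => by
    rw [← hsum, eq_one_of_card_two_eq_zero hf.1 h0]
    simp
  constructor
  · intro h
    obtain h0 | h1 : {v | f v = 2}.ncard = 0 ∨ {v | f v = 2}.ncard = 1 := by omega
    · have hn := hzero h0
      have := gammaT_le_max_card_sub_two hconn (by omega)
      omega
    · obtain ⟨x, hx⟩ := Set.ncard_eq_one.1 h1
      obtain ⟨y, hxy⟩ := hG x
      have := gammaT_le_max_card_nonneighbors hconn hxy
      have := card_nonneighbors_add_three_le_sum hf hx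
      omega
  · intro h
    by_cases h0 : {v | f v = 2}.ncard = 0
    · have hn := hzero h0
      have := gammaT_le_max_card_sub_two hconn (by omega)
      omega
    · omega
end

section
/- For every finite simple graph G of order n with maximum degree Δ(G) ≥ 2, γ_qtR(G) ≤ n − Δ(G) + 2. -/
/-- The weight of any quasi-total Roman dominating function bounds `gammaQTR`. -/
theorem gammaQTR_le_sum {V : Type*} [Fintype V] {G : SimpleGraph V} {f : V → ℕ}
    (hf : IsQTRDF G f) : gammaQTR G ≤ ∑ v, f v :=
  Nat.sInf_le ⟨f, hf, rfl⟩

/-- Label `v` by 2, one of its neighbors by 1, its other neighbors by 0 and all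
remaining vertices by 1. -/
theorem gammaQTR_add_degree_le {V : Type*} [Fintype V] (G : SimpleGraph V)
    [DecidableRel G.Adj] {v w : V} (hvw : G.Adj v w) :
    gammaQTR G + G.degree v ≤ Fintype.card V + 2 := by
  classical
  let f : V → ℕ := fun u =>
    if u = v then 2 else if u = w then 1 else if G.Adj v u then 0 else 1
  have hv : f v = 2 := if_pos rfl
  have hw : f w = 1 := by simp [f, hvw.ne']
  have hf : IsQTRDF G f := by
    refine ⟨⟨fun u => ?_, fun u hu => ⟨v, ?_, hv⟩⟩, fun x hx => ?_⟩
    · simp only [f]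
      split_ifs <;> omega
    · simp only [f] at hu
      split_ifs at hu with _ _ h
      exact h.symm
    · have hxv : x = v := by
        simp only [f] at hx
        split_ifs at hx with h
        · exact h
        all_goals omega
      exact ⟨w, hxv ▸ hvw, hw.ge⟩
  have hsum : ∑ u, f u + G.degree v = Fintype.card V + 2 := by
    have hpt : ∀ u, f u + (if G.Adj v u then 1 else 0) =
        1 + (if u = v then 1 else 0) + (if u = w then 1 else 0) := by
      intro u
      by_cases h₁ : u = v
      · subst h₁
        simp [hv, hvw.ne]
      · by_cases h₂ : u = w
        · subst h₂
          simp [hw, hvw, h₁]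
        · by_cases h₃ : G.Adj v u <;> simp [f, h₁, h₂, h₃]
    have h := Finset.sum_congr (rfl : (Finset.univ : Finset V) = Finset.univ)
      fun u _ => hpt u
    simp only [Finset.sum_add_distrib, Finset.sum_ite_eq', Finset.mem_univ, if_true,
      Finset.sum_const, Finset.card_univ, smul_eq_mul, mul_one] at h
    rw [← Finset.card_filter, ← SimpleGraph.neighborFinset_eq_filter,
      SimpleGraph.card_neighborFinset_eq_degree] at h
    omega
  have := gammaQTR_le_sum hf
  omega

theorem stmt11 {V : Type*} [Fintype V] (G : SimpleGraph V) [DecidableRel G.Adj]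
    (hΔ : 2 ≤ G.maxDegree) :
    (gammaQTR G : ℤ) ≤ (Fintype.card V : ℤ) - G.maxDegree + 2 := by
  have : Nonempty V := by
    by_contra h
    rw [not_nonempty_iff] at h
    simp at hΔ
  obtain ⟨v, hv⟩ := G.exists_maximal_degree_vertex
  obtain ⟨w, hw⟩ := (G.degree_pos_iff_exists_adj v).mp (by omega)
  have := gammaQTR_add_degree_le G hw
  omega
end
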